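/- Let π be a linear monadic datalogΟ program in which every IDB atom occurring in a rule body carries a prefix ○^k with k ∈ {−1, 0, 1}, let 𝒟 be a temporal database over EDB(π) with tem(𝒟) = [l, r], let K_π be the maximal number of nested temporal operators in a rule body of π, and set M = 2·(|IDB(π)| · |Δ_𝒟|)². If there exists an initialized entailment sequence from C₀(c₀) at some ℓ₀ ∈ [l, r] in 𝒟, then there exists an initialized entailment sequence C₀(c₀) ←_{ℓ₀,k₀} C₁(c₁) ←_{ℓ₁,k₁} … ←_{ℓ_{n−1},k_{n−1}} C_n(c_n) from C₀(c₀) at ℓ₀ all of whose timestamps satisfy ℓ_i ∈ [l − K_π − M, r + K_π + M]. -/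

import Mathlib

set_option linter.unusedVariables false

open scoped Classical

/-! ## Schemas, atoms, temporal databases -/

structure Schema : Type 1 where
  Rel : Type
  arity : Rel → ℕ

def Atom (σ : Schema) (Obj : Type) : Type := Σ R : σ.Rel, (Fin (σ.arity R) → Obj)

/-- A temporal database: a finite sequence of finite slices `D_l, …, D_r`. -/
structure TemporalDB (σ : Schema) (Obj : Type) : Type where
  l : ℤ
  r : ℤ
  hle : l ≤ r
  slice : ℤ → Set (Atom σ Obj)
  support : ∀ t : ℤ, t < l ∨ r < t → slice t = ∅
  finite : ∀ t : ℤ, (slice t).Finite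

namespace TemporalDB
variable {σ : Schema} {Obj : Type}
/-- The set of objects occurring in the temporal database. -/
def Δ (D : TemporalDB σ Obj) : Set Obj := {d | ∃ t : ℤ, ∃ a ∈ D.slice t, ∃ i, a.2 i = d}
end TemporalDB

/-! ## Temporal conjunctive query bodies -/

inductive TCQ (σ : Schema) (V : Type) : Type where
  | atom (R : σ.Rel) (args : Fin (σ.arity R) → V)
  | and (φ ψ : TCQ σ V)
  | next (φ : TCQ σ V)
  | prev (φ : TCQ σ V)
  | diaF (φ : TCQ σ V)
  | diaP (φ : TCQ σ V)

namespace TCQ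
variable {σ : Schema} {Obj V : Type}

def sat (D : TemporalDB σ Obj) (ν : V → Obj) : TCQ σ V → ℤ → Prop
  | .atom R a, ℓ => D.l ≤ ℓ ∧ ℓ ≤ D.r ∧ (⟨R, fun i => ν (a i)⟩ : Atom σ Obj) ∈ D.slice ℓ
  | .and φ ψ, ℓ => sat D ν φ ℓ ∧ sat D ν ψ ℓ
  | .next φ, ℓ => sat D ν φ (ℓ + 1)
  | .prev φ, ℓ => sat D ν φ (ℓ - 1)
  | .diaF φ, ℓ => ∃ ℓ' : ℤ, ℓ < ℓ' ∧ sat D ν φ ℓ'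
  | .diaP φ, ℓ => ∃ ℓ' : ℤ, ℓ' < ℓ ∧ sat D ν φ ℓ'

/-- Number of temporal operators occurring in the body. -/
def numOps : TCQ σ V → ℕ
  | .atom _ _ => 0
  | .and φ ψ => φ.numOps + ψ.numOps
  | .next φ => φ.numOps + 1
  | .prev φ => φ.numOps + 1
  | .diaF φ => φ.numOps + 1
  | .diaP φ => φ.numOps + 1

/-- The body contains no occurrence of ◇ or ◇⁻. -/
def nextOnly : TCQ σ V → Prop
  | .atom _ _ => True
  | .and φ ψ => φ.nextOnly ∧ ψ.nextOnly
  | .next φ => φ.nextOnly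
  | .prev φ => φ.nextOnly
  | .diaF _ => False
  | .diaP _ => False

/-- The set of temporalised atoms `○^k R(Z̄)` of a ◇-free body, as pairs (offset, atom). -/
def offAtoms : TCQ σ V → ℤ → Set (ℤ × Σ R : σ.Rel, (Fin (σ.arity R) → V))
  | .atom R a, c => {(c, ⟨R, a⟩)}
  | .and φ ψ, c => φ.offAtoms c ∪ ψ.offAtoms c
  | .next φ, c => φ.offAtoms (c + 1)
  | .prev φ, c => φ.offAtoms (c - 1)
  | .diaF _, _ => ∅
  | .diaP _, _ => ∅

end TCQ

/-! ## Two-sorted first-order logic FO(<) -/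

inductive FOlt (σ : Schema) : Type where
  | rel (R : σ.Rel) (args : Fin (σ.arity R) → ℕ) (t : ℕ)
  | lt (t t' : ℕ)
  | fals
  | not (φ : FOlt σ)
  | and (φ ψ : FOlt σ)
  | or (φ ψ : FOlt σ)
  | exObj (v : ℕ) (φ : FOlt σ)
  | allObj (v : ℕ) (φ : FOlt σ)
  | exTime (v : ℕ) (φ : FOlt σ)
  | allTime (v : ℕ) (φ : FOlt σ)

/-- Truth in the two-sorted structure `𝔖_𝒟` under assignments of the object
variables (into `Δ_𝒟`) and of the temporal variables (into `tem 𝒟`). -/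
def FOlt.sat {σ : Schema} {Obj : Type} (D : TemporalDB σ Obj) :
    FOlt σ → (ℕ → Obj) → (ℕ → ℤ) → Prop
  | .rel R a t, νo, νt =>
      D.l ≤ νt t ∧ νt t ≤ D.r ∧ (⟨R, fun i => νo (a i)⟩ : Atom σ Obj) ∈ D.slice (νt t)
  | .lt t t', _, νt => νt t < νt t'
  | .fals, _, _ => False
  | .not φ, νo, νt => ¬ FOlt.sat D φ νo νt
  | .and φ ψ, νo, νt => FOlt.sat D φ νo νt ∧ FOlt.sat D ψ νo νt
  | .or φ ψ, νo, νt => FOlt.sat D φ νo νt ∨ FOlt.sat D ψ νo νt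
  | .exObj v φ, νo, νt => ∃ d ∈ D.Δ, FOlt.sat D φ (Function.update νo v d) νt
  | .allObj v φ, νo, νt => ∀ d ∈ D.Δ, FOlt.sat D φ (Function.update νo v d) νt
  | .exTime v φ, νo, νt => ∃ s : ℤ, D.l ≤ s ∧ s ≤ D.r ∧ FOlt.sat D φ νo (Function.update νt v s)
  | .allTime v φ, νo, νt => ∀ s : ℤ, D.l ≤ s → s ≤ D.r → FOlt.sat D φ νo (Function.update νt v s)
/-! ## Temporal datalog (datalogΟ) -/

/-- Temporal operators ○, ○⁻, ◇, ◇⁻. -/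
inductive TOp : Type where
  | onext | oprev | diaF | diaP
deriving DecidableEq

/-- A temporalised atom `O* R(Ū)` occurring in a rule body. -/
structure PAtom (σ : Schema) (V : Type) : Type where
  ops : List TOp
  R : σ.Rel
  args : Fin (σ.arity R) → V

def PAtom.map {σ : Schema} {V W : Type} (f : V → W) (p : PAtom σ V) : PAtom σ W :=
  ⟨p.ops, p.R, fun i => f (p.args i)⟩

/-- Satisfaction of a ground atom under a prefix of temporal operators, in a
ℤ-indexed interpretation. -/
def satOps {σ : Schema} {Obj : Type} (I : ℤ → Set (Atom σ Obj)) (a : Atom σ Obj) :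
    List TOp → ℤ → Prop
  | [], ℓ => a ∈ I ℓ
  | TOp.onext :: ops, ℓ => satOps I a ops (ℓ + 1)
  | TOp.oprev :: ops, ℓ => satOps I a ops (ℓ - 1)
  | TOp.diaF :: ops, ℓ => ∃ ℓ' : ℤ, ℓ < ℓ' ∧ satOps I a ops ℓ'
  | TOp.diaP :: ops, ℓ => ∃ ℓ' : ℤ, ℓ' < ℓ ∧ satOps I a ops ℓ'

def PAtom.sat {σ : Schema} {Obj V : Type} (I : ℤ → Set (Atom σ Obj)) (ν : V → Obj)
    (ℓ : ℤ) (p : PAtom σ V) : Prop :=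
  satOps I ⟨p.R, fun i => ν (p.args i)⟩ p.ops ℓ

/-- A datalogΟ rule `C(X̄) ← O* R₁(Ū₁) ∧ … ∧ O* R_s(Ū_s)` (variables are natural
numbers). -/
structure Rule (σ : Schema) : Type where
  head : σ.Rel
  hargs : Fin (σ.arity head) → ℕ
  body : List (PAtom σ ℕ)

/-- A datalogΟ program: a finite set (list) of rules. -/
structure Program (σ : Schema) : Type where
  rules : List (Rule σ)

namespace Program
variable {σ : Schema}

/-- The IDB relations: those occurring in rule heads. -/
def IDB (π : Program σ) : Set σ.Rel := {R | ∃ r ∈ π.rules, r.head = R}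

/-- Every head variable occurs in the corresponding body. -/
def Safe (π : Program σ) : Prop :=
  ∀ r ∈ π.rules, ∀ i, ∃ p ∈ r.body, ∃ j, p.args j = r.hargs i

/-- Every rule body contains at most one IDB atom. -/
def Linear (π : Program σ) : Prop :=
  ∀ r ∈ π.rules, (∀ p ∈ r.body, p.R ∉ π.IDB) ∨
    ∃ L₁ a L₂, r.body = L₁ ++ a :: L₂ ∧ a.R ∈ π.IDB ∧
      (∀ p ∈ L₁, p.R ∉ π.IDB) ∧ (∀ p ∈ L₂, p.R ∉ π.IDB)

/-- Every IDB relation is unary. -/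
def Monadic (π : Program σ) : Prop := ∀ R ∈ π.IDB, σ.arity R = 1

/-- Only the operators ○ and ○⁻ occur in the program. -/
def NextOnly (π : Program σ) : Prop :=
  ∀ r ∈ π.rules, ∀ p ∈ r.body, ∀ o ∈ p.ops, o = TOp.onext ∨ o = TOp.oprev

/-- `K_π`: the maximal number of nested temporal operators in a rule body. -/
def depth (π : Program σ) : ℕ :=
  (π.rules.map (fun r => (r.body.map (fun p => p.ops.length)).foldr max 0)).foldr max 0

end Program

def PAtom.size {σ : Schema} (p : PAtom σ ℕ) : ℕ := 1 + p.ops.length + σ.arity p.R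

def Rule.size {σ : Schema} (r : Rule σ) : ℕ :=
  1 + σ.arity r.head + (r.body.map PAtom.size).sum

/-- The size `|π|` of a program. -/
def Program.size {σ : Schema} (π : Program σ) : ℕ := (π.rules.map Rule.size).sum

/-- The Gaifman graph of the body is connected. -/
def BodyConnected {σ : Schema} (L : List (PAtom σ ℕ)) : Prop :=
  ∀ u v : ℕ, (∃ p ∈ L, ∃ i, p.args i = u) → (∃ p ∈ L, ∃ i, p.args i = v) →
    Relation.ReflTransGen (fun x y => ∃ p ∈ L, (∃ i, p.args i = x) ∧ ∃ j, p.args j = y) u v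

def Program.Connected {σ : Schema} (π : Program σ) : Prop :=
  ∀ r ∈ π.rules, BodyConnected r.body

/-- The temporal database only mentions EDB relations of `π`. -/
def OverEDB {σ : Schema} {Obj : Type} (π : Program σ) (D : TemporalDB σ Obj) : Prop :=
  ∀ t : ℤ, ∀ a ∈ D.slice t, a.1 ∉ π.IDB

/-! ### Enrichments, models and certain answers.
These are formulated for an abstract database given by a set `Δ` of objects
together with a ℤ-indexed family `I` of sets of (EDB) atoms. -/

/-- `E` is an enrichment of the database `(Δ, I)`: its EDB atoms are exactly
those of `I` and all its objects come from `Δ`. -/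
def IsEnrichment {σ : Schema} {Obj : Type} (π : Program σ) (Δ : Set Obj)
    (I : ℤ → Set (Atom σ Obj)) (E : ℤ → Set (Atom σ Obj)) : Prop :=
  (∀ t : ℤ, ∀ a ∈ I t, a ∈ E t) ∧
  (∀ t : ℤ, ∀ a ∈ E t, a.1 ∉ π.IDB → a ∈ I t) ∧
  (∀ t : ℤ, ∀ a ∈ E t, ∀ i, a.2 i ∈ Δ)

/-- `E` satisfies the rule `r` at every time point, for all assignments of the
variables into `Δ`. -/
def SatRule {σ : Schema} {Obj : Type} (Δ : Set Obj) (E : ℤ → Set (Atom σ Obj))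
    (r : Rule σ) : Prop :=
  ∀ ν : ℕ → Obj, (∀ v, ν v ∈ Δ) → ∀ ℓ : ℤ,
    (∀ p ∈ r.body, PAtom.sat E ν ℓ p) →
    (⟨r.head, fun i => ν (r.hargs i)⟩ : Atom σ Obj) ∈ E ℓ

/-- `E` is a model of `π` and the database `(Δ, I)`. -/
def IsModel {σ : Schema} {Obj : Type} (π : Program σ) (Δ : Set Obj)
    (I : ℤ → Set (Atom σ Obj)) (E : ℤ → Set (Atom σ Obj)) : Prop :=
  IsEnrichment π Δ I E ∧ ∀ r ∈ π.rules, SatRule Δ E r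

/-- Certain answers: `a` holds at time `ℓ` in every model of `π` and `(Δ, I)`;
this is the relation `𝒟, π, ℓ ⊨ a`. -/
def Certain {σ : Schema} {Obj : Type} (π : Program σ) (Δ : Set Obj)
    (I : ℤ → Set (Atom σ Obj)) (ℓ : ℤ) (a : Atom σ Obj) : Prop :=
  ∀ E : ℤ → Set (Atom σ Obj), IsModel π Δ I E → a ∈ E ℓ

/-! ### Expansions of linear monadic queries -/

/-- Standard renaming making the head variable `x` the answer variable `0` and
moving all other variables injectively away from `0`. -/
def stdRen (x : ℕ) : ℕ → ℕ := fun v => if v = x then 0 else v + 1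

def PAtom.maxVar {σ : Schema} (p : PAtom σ ℕ) : ℕ := Finset.univ.sup p.args

def bodyMaxVar {σ : Schema} (L : List (PAtom σ ℕ)) : ℕ :=
  (L.map PAtom.maxVar).foldr max 0

/-- Renaming used for composition: the answer variable `0` of the inner query is
mapped to `y` and all other variables are shifted beyond `N` (fresh). -/
def compRen (y N : ℕ) : ℕ → ℕ := fun v => if v = 0 then y else v + N

/-- Composition `Q ∘ P`: the unique IDB atom (with prefix `ops` and variable `y`)
of the outer query is replaced by the renamed-apart inner query `w`. -/
def composeW {σ : Schema} (base : List (PAtom σ ℕ)) (ops : List TOp) (y : ℕ)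
    (w : List (PAtom σ ℕ)) : List (PAtom σ ℕ) :=
  base ++ w.map (fun p =>
    ⟨ops ++ p.ops, p.R, fun i => compRen y (max (bodyMaxVar base) y) (p.args i)⟩)

/-- `IsExpansion π C w`: `w` (a unary temporal CQ with answer variable `0`) is an
expansion of the query `(π, C)`. -/
inductive IsExpansion {σ : Schema} (π : Program σ) : σ.Rel → List (PAtom σ ℕ) → Prop where
  | init (r : Rule σ) (x : ℕ) (hr : r ∈ π.rules) (hx : ∀ i, r.hargs i = x)
      (hinit : ∀ p ∈ r.body, p.R ∉ π.IDB) :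
      IsExpansion π r.head (r.body.map (PAtom.map (stdRen x)))
  | step (r : Rule σ) (x : ℕ) (hr : r ∈ π.rules) (hx : ∀ i, r.hargs i = x)
      (L₁ L₂ : List (PAtom σ ℕ)) (a : PAtom σ ℕ) (y : ℕ)
      (hbody : r.body = L₁ ++ a :: L₂) (hIDB : a.R ∈ π.IDB)
      (hE : ∀ p ∈ L₁ ++ L₂, p.R ∉ π.IDB) (hy : ∀ j, a.args j = y)
      (w : List (PAtom σ ℕ)) (hw : IsExpansion π a.R w) :
      IsExpansion π r.head
        (composeW ((L₁ ++ L₂).map (PAtom.map (stdRen x))) a.ops (stdRen x y) w)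

/-- `𝒟, ℓ ⊨ w(d)` for a unary temporal CQ `w` with answer variable `0`. -/
def ExpSat {σ : Schema} {Obj : Type} (D : TemporalDB σ Obj) (ℓ : ℤ)
    (w : List (PAtom σ ℕ)) (d : Obj) : Prop :=
  ∃ ν : ℕ → Obj, (∀ v, ν v ∈ D.Δ) ∧ ν 0 = d ∧ ∀ p ∈ w, PAtom.sat D.slice ν ℓ p

/-- The set of variables occurring in a temporal CQ given as a list of
temporalised atoms. -/
def bodyVars {σ : Schema} (w : List (PAtom σ ℕ)) : Set ℕ :=
  {v | ∃ p ∈ w, ∃ j, p.args j = v}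

/-! ### Entailment sequences for linear programs -/

/-- The prefix `○^k` for `k ∈ {-1, 0, 1}`. -/
def opsOfInt (k : ℤ) : List TOp :=
  if k = 1 then [TOp.onext] else if k = -1 then [TOp.oprev] else []

/-- `C(c̄) ←_{ℓ,k} D(d̄)`: some recursive rule of `π` whose IDB atom carries the
prefix `○^k` witnesses the step at time `ℓ` in the database `D`. -/
def StepRel {σ : Schema} {Obj : Type} (π : Program σ) (D : TemporalDB σ Obj)
    (ℓ k : ℤ) (ca da : Atom σ Obj) : Prop :=
  ∃ r ∈ π.rules, ∃ L₁ a L₂, r.body = L₁ ++ a :: L₂ ∧ a.R ∈ π.IDB ∧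
    (∀ p ∈ L₁ ++ L₂, p.R ∉ π.IDB) ∧ a.ops = opsOfInt k ∧
    ∃ ν : ℕ → Obj, (∀ v, ν v ∈ D.Δ) ∧
      ca = ⟨r.head, fun i => ν (r.hargs i)⟩ ∧ da = ⟨a.R, fun i => ν (a.args i)⟩ ∧
      ∀ p ∈ L₁ ++ L₂, PAtom.sat D.slice ν ℓ p

/-- `C(c̄) ←_ℓ`: some initialisation rule of `π` witnesses `C(c̄)` at time `ℓ`. -/
def InitRel {σ : Schema} {Obj : Type} (π : Program σ) (D : TemporalDB σ Obj)
    (ℓ : ℤ) (ca : Atom σ Obj) : Prop :=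
  ∃ r ∈ π.rules, (∀ p ∈ r.body, p.R ∉ π.IDB) ∧
    ∃ ν : ℕ → Obj, (∀ v, ν v ∈ D.Δ) ∧ ca = ⟨r.head, fun i => ν (r.hargs i)⟩ ∧
      ∀ p ∈ r.body, PAtom.sat D.slice ν ℓ p

/-- An entailment sequence `C₀(c̄₀) ←_{ℓ₀,k₀} C₁(c̄₁) ←_{ℓ₁,k₁} … ←_{ℓ_{n−1},k_{n−1}} C_n(c̄_n)`. -/
def IsEntSeq {σ : Schema} {Obj : Type} (π : Program σ) (D : TemporalDB σ Obj)
    (n : ℕ) (A : Fin (n+1) → Atom σ Obj) (ℓs : Fin (n+1) → ℤ) (ks : Fin n → ℤ) : Prop :=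
  ∀ i : Fin n, ks i ∈ ({-1, 0, 1} : Set ℤ) ∧
    StepRel π D (ℓs i.castSucc) (ks i) (A i.castSucc) (A i.succ) ∧
    ℓs i.succ = ℓs i.castSucc + ks i

/-- An initialized entailment sequence. -/
def IsInitEntSeq {σ : Schema} {Obj : Type} (π : Program σ) (D : TemporalDB σ Obj)
    (n : ℕ) (A : Fin (n+1) → Atom σ Obj) (ℓs : Fin (n+1) → ℤ) (ks : Fin n → ℤ) : Prop :=
  IsEntSeq π D n A ℓs ks ∧ InitRel π D (ℓs (Fin.last n)) (A (Fin.last n))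

/-- Every IDB atom occurring in a rule body carries a prefix `○^k` with `k ∈ {-1,0,1}`. -/
def SmallIDBPrefix {σ : Schema} (π : Program σ) : Prop :=
  ∀ r ∈ π.rules, ∀ p ∈ r.body, p.R ∈ π.IDB →
    p.ops = [] ∨ p.ops = [TOp.onext] ∨ p.ops = [TOp.oprev]

/-! ### Cut models -/

/-- `r(d)`: the maximal timestamp at which `D` contains an atom involving `d`. -/
noncomputable def maxT {σ : Schema} {Obj : Type} (D : TemporalDB σ Obj) (d : Obj) : ℤ :=
  sSup {t : ℤ | ∃ a ∈ D.slice t, ∃ i, a.2 i = d}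

/-- `−l(d)`: the minimal timestamp at which `D` contains an atom involving `d`. -/
noncomputable def minT {σ : Schema} {Obj : Type} (D : TemporalDB σ Obj) (d : Obj) : ℤ :=
  sInf {t : ℤ | ∃ a ∈ D.slice t, ∃ i, a.2 i = d}

/-- `F` is an `n`-cut model of `D` and `π`: obtained from a model by discarding,
for every object `d`, all atoms involving `d` with timestamp outside
`[−l(d)−n, r(d)+n]`. -/
def IsCutModel {σ : Schema} {Obj : Type} (π : Program σ) (D : TemporalDB σ Obj)
    (n : ℕ) (F : ℤ → Set (Atom σ Obj)) : Prop :=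
  ∃ E : ℤ → Set (Atom σ Obj), IsModel π D.Δ D.slice E ∧
    ∀ t : ℤ, F t = {a | a ∈ E t ∧ ∀ d : Obj, (∃ i, a.2 i = d) →
      minT D d - n ≤ t ∧ t ≤ maxT D d + n}
/-! ## 2-counter (Minsky) machines and the program `π_M` -/

/-- A 2-counter machine with states `s₀, …, s_n` (`s₀` initial) and partial
transition function `Θ`; `Bool` encodes the signs (`true` = `+`, `false` = `0`)
and `Fin 3` encodes the counter updates `−1, 0, 1` (via `val3`). -/
structure CM : Type where
  n : ℕ
  Θ : Fin (n+1) → Bool → Bool → Option (Fin (n+1) × Fin 3 × Fin 3)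

def val3 (e : Fin 3) : ℤ := (e : ℤ) - 1

def CM.step (M : CM) (c : Fin (M.n+1) × ℤ × ℤ) : Option (Fin (M.n+1) × ℤ × ℤ) :=
  (M.Θ c.1 (decide (0 < c.2.1)) (decide (0 < c.2.2))).map
    (fun x => (x.1, c.2.1 + val3 x.2.1, c.2.2 + val3 x.2.2))

/-- The computation of `M` (configuration after `k` steps, if defined). -/
def CM.run (M : CM) : ℕ → Option (Fin (M.n+1) × ℤ × ℤ)
  | 0 => some (0, 0, 0)
  | k+1 => (M.run k).bind M.step

/-- The counters stay nonnegative along the computation. -/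
def CM.Valid (M : CM) : Prop :=
  ∀ (k : ℕ) (s : Fin (M.n+1)) (a b : ℤ), M.run k = some (s, a, b) → 0 ≤ a ∧ 0 ≤ b

/-- The relations of the schema of `π_M`: EDB relations `T, U₁, U₂` (binary) and
IDB relations `G`, `RV`, `NE_c^ε`, `S_i` (unary); `m` is the number of states. -/
inductive MRel (m : ℕ) : Type where
  | T | U1 | U2 | G | RV
  | NE (c : Bool) (e : Fin 3)
  | S (i : Fin m)
deriving DecidableEq

def MSchema (m : ℕ) : Schema :=
  ⟨MRel m, fun r => match r with
    | .T => 2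
    | .U1 => 2
    | .U2 => 2
    | _ => 1⟩

def paT {m : ℕ} (ops : List TOp) (x y : ℕ) : PAtom (MSchema m) ℕ := ⟨ops, MRel.T, ![x, y]⟩

/-- `U_c`-atom (`c = true` is `U₁`, `c = false` is `U₂`). -/
def paU {m : ℕ} : Bool → List TOp → ℕ → ℕ → PAtom (MSchema m) ℕ
  | true, ops, x, y => ⟨ops, MRel.U1, ![x, y]⟩
  | false, ops, x, y => ⟨ops, MRel.U2, ![x, y]⟩

def paRV {m : ℕ} (ops : List TOp) (x : ℕ) : PAtom (MSchema m) ℕ := ⟨ops, MRel.RV, ![x]⟩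

def paNE {m : ℕ} (c : Bool) (e : Fin 3) (ops : List TOp) (x : ℕ) : PAtom (MSchema m) ℕ :=
  ⟨ops, MRel.NE c e, ![x]⟩

def paS {m : ℕ} (i : Fin m) (ops : List TOp) (x : ℕ) : PAtom (MSchema m) ℕ :=
  ⟨ops, MRel.S i, ![x]⟩

/-- A rule with (unary) head `h(X)` where `X` is the variable `0`. -/
def mkR {m : ℕ} (h : MRel m) (body : List (PAtom (MSchema m) ℕ)) : Rule (MSchema m) :=
  ⟨h, fun _ => 0, body⟩

def dia : List TOp := [TOp.diaF]

/-- `◇^α` for a sign `α`. -/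
def dOf (b : Bool) : List TOp := if b then [TOp.diaF] else []

/-- The two prefixes realising `◇*` (`◇*φ ≡ ◇φ ∨ φ`). -/
def starPre : List (List TOp) := [[], [TOp.diaF]]

/-- Representation-violation rules (variables: `X = 0`, `Y = 1`, `Z = 2`). -/
def rvRules (m : ℕ) : List (Rule (MSchema m)) :=
  [ mkR .RV [paT [] 0 1, paT dia 0 2],
    mkR .RV [paU true [] 0 1, paU true dia 0 2],
    mkR .RV [paU false [] 0 1, paU false dia 0 2] ]

/-- Transition-violation detection rules for counter `c`
(variables: `Y = 0`, `X = 1`, `Z = 2`; `e : Fin 3` encodes `ε = e − 1`). -/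
def neRules (m : ℕ) (c : Bool) : List (Rule (MSchema m)) :=
  [ mkR (.NE c 0) [paU c [] 0 2, paU c [] 1 0],
    mkR (.NE c 0) [paU c [] 0 2, paU c [TOp.diaF, TOp.diaF] 1 0],
    mkR (.NE c 0) [paU c [] 1 0, paU c dia 0 2],
    mkR (.NE c 2) [paU c [] 0 2, paU c [] 1 0],
    mkR (.NE c 2) [paU c [] 0 2, paU c dia 1 0],
    mkR (.NE c 2) [paU c [] 1 0, paU c [TOp.diaF, TOp.diaF] 0 2],
    mkR (.NE c 1) [paU c [] 0 2, paU c dia 1 0],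
    mkR (.NE c 1) [paU c [] 1 0, paU c dia 0 2] ]

/-- The rules `S_i(X) ← ◇* RV(X)`. -/
def sRvRules (m : ℕ) : List (Rule (MSchema m)) :=
  (List.finRange m).flatMap fun i =>
    [ mkR (.S i) [paRV [] 0], mkR (.S i) [paRV dia 0] ]

/-- The rules `S_i(X) ← ◇* NE_c^ε(Y) ∧ ◇^α U_c(X,Y)` (variables `X = 0`, `Y = 1`). -/
def neViol (m : ℕ) (c : Bool) (e : Fin 3) (α : Bool) (i : Fin m) : List (Rule (MSchema m)) :=
  starPre.map fun pre => mkR (.S i) [paNE c e pre 1, paU c (dOf α) 0 1]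

/-- The transition rules of `π_M`. -/
def transRules (M : CM) : List (Rule (MSchema (M.n+1))) :=
  (List.finRange (M.n+1)).flatMap fun i =>
    [false, true].flatMap fun α =>
      [false, true].flatMap fun β =>
        match M.Θ i α β with
        | some (j, e1, e2) =>
            neViol (M.n+1) true e1 α i ++ neViol (M.n+1) false e2 β i ++
            [ mkR (.S i) [paT [] 0 1, paU true (dOf α) 0 1, paU false (dOf β) 0 1,
                paS j [] 1] ]
        | none =>
            ((List.finRange 3).flatMap fun e1 => neViol (M.n+1) true e1 α i) ++
            ((List.finRange 3).flatMap fun e2 => neViol (M.n+1) false e2 β i)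

/-- The program `π_M` associated with the 2-counter machine `M`. -/
def piM (M : CM) : Program (MSchema (M.n+1)) :=
  ⟨ [ mkR .G [paS 0 [] 0, paU true [] 0 1, paU false [] 0 1] ] ++
    rvRules (M.n+1) ++ sRvRules (M.n+1) ++
    neRules (M.n+1) true ++ neRules (M.n+1) false ++ transRules M ⟩
/-! ## The alphabet Ω and languages of words for ○/○⁻ queries -/

inductive Marker : Type where
  | bot | top
deriving DecidableEq

/-- A letter of the alphabet `Ω = 2^{Γ^r_π ∪ Γ^i_π ∪ {⊥,⊤}}` (rule bodies are
represented by their rules). -/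
abbrev Lett (σ : Schema) : Type := Set (Marker ⊕ Rule σ)

/-- `a` is the (unique, for linear rules) IDB atom of the body of `r`. -/
def RecDecomp {σ : Schema} (π : Program σ) (r : Rule σ) (a : PAtom σ ℕ) : Prop :=
  ∃ L₁ L₂, r.body = L₁ ++ a :: L₂ ∧ a.R ∈ π.IDB ∧
    (∀ p ∈ L₁, p.R ∉ π.IDB) ∧ (∀ p ∈ L₂, p.R ∉ π.IDB)

/-- An initialisation rule: no IDB atom in the body. -/
def IsInitRule {σ : Schema} (π : Program σ) (r : Rule σ) : Prop :=
  ∀ p ∈ r.body, p.R ∉ π.IDB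

/-- A horizontal recursive rule: the IDB atom uses the head variable. -/
def IsHorizontalR {σ : Schema} (π : Program σ) (r : Rule σ) : Prop :=
  ∃ a, RecDecomp π r a ∧ ∀ j i, a.args j = r.hargs i

/-- A vertical recursive rule: the IDB atom uses a variable different from the
head variable. -/
def IsVerticalR {σ : Schema} (π : Program σ) (r : Rule σ) : Prop :=
  ∃ a, RecDecomp π r a ∧ ∃ j i, a.args j ≠ r.hargs i

/-- A vertical letter: a singleton containing a vertical rule body. -/
def IsVertLett {σ : Schema} (π : Program σ) (Λ : Lett σ) : Prop :=
  ∃ r ∈ π.rules, IsVerticalR π r ∧ Λ = {Sum.inr r}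

/-- A horizontal letter: a set of horizontal (or initialisation) rule bodies,
possibly containing the markers ⊥, ⊤. -/
def IsHorLett {σ : Schema} (π : Program σ) (Λ : Lett σ) : Prop :=
  ∀ x ∈ Λ, x = Sum.inl Marker.bot ∨ x = Sum.inl Marker.top ∨
    ∃ r ∈ π.rules, x = Sum.inr r ∧ (IsHorizontalR π r ∨ IsInitRule π r)

def TOp.shift : TOp → ℤ
  | .onext => 1
  | .oprev => -1
  | .diaF => 0
  | .diaP => 0

/-- The net time shift of a prefix of ○/○⁻ operators. -/
def netShift (ops : List TOp) : ℤ := (ops.map TOp.shift).sum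

/-- The time shift `m` of the IDB atom `○^m C(Y)` of a recursive rule. -/
noncomputable def idbShift {σ : Schema} (π : Program σ) (r : Rule σ) : ℤ :=
  if h : ∃ a, RecDecomp π r a then netShift h.choose.ops else 0

/-- A decomposition of a word over `Ω` into alternating vertical segments
(given by their lists of vertical rules together with their IDB atoms) and
horizontal segments, together with the positions of ⊥ and ⊤ in each horizontal
segment. -/
structure SegData (σ : Schema) : Type where
  n : ℕ
  xs : Fin n → List (Rule σ)
  axs : (i : Fin n) → Fin (xs i).length → PAtom σ ℕ
  ys : Fin n → List (Lett σ)
  botIdx : Fin n → ℕ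
  topIdx : Fin n → ℕ

/-- The word over `Ω` determined by a decomposition. -/
def SegData.word {σ : Schema} (d : SegData σ) : List (Lett σ) :=
  (List.ofFn fun i => ((d.xs i).map fun r => ({Sum.inr r} : Lett σ)) ++ d.ys i).flatten

/-- `x` occurs in exactly one letter of `y`, namely in the one at position `k`. -/
def ExactlyOneAt {σ : Schema} (x : Marker ⊕ Rule σ) (y : List (Lett σ)) (k : ℕ) : Prop :=
  ∃ h : k < y.length, x ∈ y.get ⟨k, h⟩ ∧
    ∀ k' (h' : k' < y.length), x ∈ y.get ⟨k', h'⟩ → k' = k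

/-- The decomposition is a correct one for `π`:  vertical segments consist of
vertical rules, horizontal segments of horizontal letters, inner segments are
nonempty (maximality), every horizontal segment preceded by a vertical segment
contains exactly one ⊥ (at `botIdx`), every horizontal segment followed by a
vertical segment contains exactly one ⊤ (at `topIdx`); for a leading horizontal
segment, `botIdx` is the time-0 anchor. -/
structure GoodSeg {σ : Schema} (π : Program σ) (d : SegData σ) : Prop where
  mem : ∀ (i : Fin d.n) (p : Fin (d.xs i).length), (d.xs i).get p ∈ π.rules
  recd : ∀ (i : Fin d.n) (p : Fin (d.xs i).length), RecDecomp π ((d.xs i).get p) (d.axs i p)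
  vert : ∀ (i : Fin d.n) (p : Fin (d.xs i).length),
    ∃ j i', (d.axs i p).args j ≠ ((d.xs i).get p).hargs i'
  hor : ∀ i : Fin d.n, ∀ Λ ∈ d.ys i, IsHorLett π Λ
  xs_ne : ∀ i : Fin d.n, (i : ℕ) ≠ 0 → d.xs i ≠ []
  ys_ne : ∀ i : Fin d.n, (i : ℕ) ≠ d.n - 1 → d.ys i ≠ []
  bot_one : ∀ i : Fin d.n, d.xs i ≠ [] → d.ys i ≠ [] →
    ExactlyOneAt (Sum.inl Marker.bot) (d.ys i) (d.botIdx i)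
  bot_anchor : ∀ i : Fin d.n, d.xs i = [] →
    ((∃ k, ∃ h : k < (d.ys i).length, Sum.inl Marker.bot ∈ (d.ys i).get ⟨k, h⟩) →
      ∃ h : d.botIdx i < (d.ys i).length,
        Sum.inl Marker.bot ∈ (d.ys i).get ⟨d.botIdx i, h⟩)
  bot_anchor' : ∀ i : Fin d.n, d.xs i = [] →
    (¬ (∃ k, ∃ h : k < (d.ys i).length, Sum.inl Marker.bot ∈ (d.ys i).get ⟨k, h⟩)) →
      d.botIdx i = 0
  top_one : ∀ i : Fin d.n, (i : ℕ) < d.n - 1 →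
    ExactlyOneAt (Sum.inl Marker.top) (d.ys i) (d.topIdx i)

/-- A correct word over `Ω`. -/
def Correct {σ : Schema} (π : Program σ) (α : List (Lett σ)) : Prop :=
  ∃ d : SegData σ, GoodSeg π d ∧ d.word = α

/-! ### The temporal database `𝒟_α` of a correct word -/

/-- Time offset, within the vertical part of segment `i`, of the `p`-th vertical
rule (sum of the IDB-prefix shifts of the earlier rules of the segment). -/
noncomputable def vtimeOff {σ : Schema} (d : SegData σ) (i : Fin d.n) (p : ℕ) : ℤ :=
  ∑ q : Fin (d.xs i).length, if (q : ℕ) < p then netShift (d.axs i q).ops else 0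

/-- The entry time of segment `i` (time at which the first body of the segment
lands). -/
noncomputable def segEntry {σ : Schema} (d : SegData σ) : ℕ → ℤ
  | 0 => 0
  | i+1 =>
    if h : i < d.n then
      segEntry d i + vtimeOff d ⟨i, h⟩ (d.xs ⟨i, h⟩).length +
        ((d.topIdx ⟨i, h⟩ : ℤ) - (d.botIdx ⟨i, h⟩ : ℤ))
    else segEntry d i

/-- The landing time of the `p`-th vertical rule of segment `i`. -/
noncomputable def vtime {σ : Schema} (d : SegData σ) (i : Fin d.n) (p : ℕ) : ℤ :=
  segEntry d i + vtimeOff d i p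

/-- The time of the `j`-th letter of the horizontal part of segment `i`
(the letter at `botIdx` sits at the exit time of the vertical part). -/
noncomputable def htime {σ : Schema} (d : SegData σ) (i : Fin d.n) (j : ℕ) : ℤ :=
  segEntry d i + vtimeOff d i (d.xs i).length + ((j : ℤ) - (d.botIdx i : ℤ))

/-- The number of vertical rules in the segments before segment `i` (used for
the indices of the spine variables). -/
def sOf {σ : Schema} (d : SegData σ) (i : ℕ) : ℕ :=
  ∑ j ∈ Finset.range i, if h : j < d.n then (d.xs ⟨j, h⟩).length else 0

/-- The objects of `𝒟_α`: spine variables (`Sum.inl`) and renamed-apart copies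
of the remaining variables of each body occurrence (`Sum.inr`). -/
def WObj (σ : Schema) : Type := ℕ ⊕ (ℕ × ℕ × Rule σ × ℕ)

/-- Renaming of the variables of the `p`-th vertical rule of segment `i`:
head variable ↦ its spine variable, IDB variable ↦ the next spine variable,
other variables ↦ fresh copies. -/
noncomputable def vRen {σ : Schema} (d : SegData σ) (i : Fin d.n)
    (p : Fin (d.xs i).length) (v : ℕ) : WObj σ :=
  if ∃ ii, ((d.xs i).get p).hargs ii = v then Sum.inl (sOf d i + p)
  else if ∃ jj, (d.axs i p).args jj = v then Sum.inl (sOf d i + p + 1)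
  else Sum.inr (i, p, (d.xs i).get p, v)

/-- Renaming of the variables of a body `r` occurring in the `j`-th letter of
the horizontal part of segment `i`: head variable ↦ the spine variable shared by
the whole horizontal segment, other variables ↦ fresh copies. -/
noncomputable def hRen {σ : Schema} (d : SegData σ) (i : Fin d.n) (j : ℕ)
    (r : Rule σ) (v : ℕ) : WObj σ :=
  if ∃ ii, r.hargs ii = v then Sum.inl (sOf d i + (d.xs i).length)
  else Sum.inr (i, (d.xs i).length + j, r, v)

/-- The slices of the temporal database `𝒟_α` determined by a decomposition:
the (EDB atoms of the) bodies of the word, placed at their time offsets, with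
variables renamed apart along the composition. -/
noncomputable def segSlice {σ : Schema} (π : Program σ) (d : SegData σ) (t : ℤ) :
    Set (Atom σ (WObj σ)) :=
  {a | (∃ i : Fin d.n, ∃ p : Fin (d.xs i).length, ∃ q ∈ ((d.xs i).get p).body,
          q.R ∉ π.IDB ∧ t = vtime d i p + netShift q.ops ∧
          a = ⟨q.R, fun z => vRen d i p (q.args z)⟩) ∨
       (∃ i : Fin d.n, ∃ j : Fin (d.ys i).length, ∃ r : Rule σ,
          Sum.inr r ∈ (d.ys i).get j ∧ ∃ q ∈ r.body, q.R ∉ π.IDB ∧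
          t = htime d i j + netShift q.ops ∧
          a = ⟨q.R, fun z => hRen d i j r (q.args z)⟩)}

/-- The objects occurring in `𝒟_α`. -/
noncomputable def segΔ {σ : Schema} (π : Program σ) (d : SegData σ) : Set (WObj σ) :=
  {o | ∃ t : ℤ, ∃ a ∈ segSlice π d t, ∃ i, a.2 i = o}

/-- `Accept(π, G)`: the correct words `α` with `𝒟_α, π, 0 ⊨ G(X)`, where `X` is
the answer variable (the first spine variable) of `Q_α`. -/
noncomputable def Accept {σ : Schema} (π : Program σ) (G : σ.Rel)
    (α : List (Lett σ)) : Prop :=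
  ∃ d : SegData σ, GoodSeg π d ∧ d.word = α ∧
    Certain π (segΔ π d) (segSlice π d) 0 ⟨G, fun _ => Sum.inl 0⟩

/-- The height of a word: its number of vertical letters. -/
noncomputable def height {σ : Schema} (π : Program σ) (α : List (Lett σ)) : ℕ :=
  Set.ncard {k : Fin α.length | IsVertLett π (α.get k)}

/-- `(π, G)` is vertically unbounded. -/
noncomputable def VUnbounded {σ : Schema} (π : Program σ) (G : σ.Rel) : Prop :=
  ∀ k : ℕ, ∃ α : List (Lett σ), Accept π G α ∧ height π α > k ∧
    ∀ β, β <+: α → height π β = k → ¬ Accept π G β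

/-- The relation `α ≼ β`: same vertical segments, and each horizontal segment of
`α` embeds letterwise (as sets, after a shift) into the corresponding horizontal
segment of `β`. -/
def PrecEq {σ : Schema} (π : Program σ) (α β : List (Lett σ)) : Prop :=
  ∃ (n : ℕ) (xs : Fin n → List (Rule σ)) (ys ys' : Fin n → List (Lett σ)),
    (∀ i, ∀ r ∈ xs i, r ∈ π.rules ∧ IsVerticalR π r) ∧
    (∀ i, ∀ Λ ∈ ys i, IsHorLett π Λ) ∧
    (∀ i, ∀ Λ ∈ ys' i, IsHorLett π Λ) ∧
    α = (List.ofFn fun i => ((xs i).map fun r => ({Sum.inr r} : Lett σ)) ++ ys i).flatten ∧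
    β = (List.ofFn fun i => ((xs i).map fun r => ({Sum.inr r} : Lett σ)) ++ ys' i).flatten ∧
    ∀ i, ∃ k, ∃ hk : (ys i).length + k ≤ (ys' i).length,
      ∀ j (hj : j < (ys i).length),
        (ys i).get ⟨j, hj⟩ ⊆ (ys' i).get ⟨j + k, by omega⟩
/-! ### Expansions as words of rule bodies, and their descriptions -/

/-- `IsExpSeq π C w`: the sequence of rules `w` is an expansion of `(π, C)`,
i.e. a word in `(Γ^r_π)* Γ^i_π` following the rules of `π` from head `C`. -/
inductive IsExpSeq {σ : Schema} (π : Program σ) : σ.Rel → List (Rule σ) → Prop where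
  | init (r : Rule σ) (hr : r ∈ π.rules) (hi : IsInitRule π r) : IsExpSeq π r.head [r]
  | step (r : Rule σ) (a : PAtom σ ℕ) (hr : r ∈ π.rules) (ha : RecDecomp π r a)
      (w : List (Rule σ)) (hw : IsExpSeq π a.R w) : IsExpSeq π r.head (r :: w)

/-- Landing time `ℓ_{j+1} = Σ_{i ≤ j} m_i` of the `j`-th body of a horizontal
run (`landing h h.length` is the exit time of the run). -/
noncomputable def landing {σ : Schema} (π : Program σ) (h : List (Rule σ)) (j : ℕ) : ℤ :=
  ∑ i ∈ Finset.range j, ((h[i]?).map (idbShift π)).getD 0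

noncomputable def landSet {σ : Schema} (π : Program σ) (h : List (Rule σ)) : Finset ℤ :=
  (Finset.range (h.length + 1)).image (landing π h)

noncomputable def landLo {σ : Schema} (π : Program σ) (h : List (Rule σ)) : ℤ :=
  (landSet π h).min' ((Finset.nonempty_range_iff.mpr (Nat.succ_ne_zero _)).image _)

noncomputable def landHi {σ : Schema} (π : Program σ) (h : List (Rule σ)) : ℤ :=
  (landSet π h).max' ((Finset.nonempty_range_iff.mpr (Nat.succ_ne_zero _)).image _)

/-- The letter of the description of a horizontal run `h` at time point `t`:
the set of bodies of the run landing at `t`, with ⊥ at the landing point of the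
first body and (when the run is followed by a vertical segment) ⊤ at the exit
point. -/
def hLetter {σ : Schema} (π : Program σ) (h : List (Rule σ)) (withTop : Bool)
    (t : ℤ) : Lett σ :=
  {x | (∃ j : ℕ, ∃ r, h[j]? = some r ∧ landing π h j = t ∧ x = Sum.inr r) ∨
       (t = 0 ∧ x = Sum.inl Marker.bot) ∨
       (withTop = true ∧ t = landing π h h.length ∧ x = Sum.inl Marker.top)}

/-- The description of a (maximal) horizontal run, as a word of letters along
its timeline. -/
noncomputable def layoutH {σ : Schema} (π : Program σ) (h : List (Rule σ))
    (withTop : Bool) : List (Lett σ) :=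
  (List.range ((landHi π h - landLo π h).toNat + 1)).map fun k =>
    hLetter π h withTop (landLo π h + (k : ℤ))

theorem length_dropWhile_le' {α : Type*} (p : α → Bool) (l : List α) :
    (l.dropWhile p).length ≤ l.length := by
  induction l with
  | nil => simp
  | cons a l ih =>
    by_cases h : p a <;> simp [List.dropWhile, h] <;> omega

/-- The description `[w] ∈ Ω*` of a composition `w` of rule bodies: vertical
bodies become singleton letters, maximal horizontal runs are laid out along
their timelines. -/
noncomputable def descr {σ : Schema} (π : Program σ) : List (Rule σ) → List (Lett σ)
  | [] => []
  | r :: rest =>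
    if IsVerticalR π r then ({Sum.inr r} : Lett σ) :: descr π rest
    else
      layoutH π (r :: rest.takeWhile fun r' => !decide (IsVerticalR π r'))
        (!(rest.dropWhile fun r' => !decide (IsVerticalR π r')).isEmpty)
        ++ descr π (rest.dropWhile fun r' => !decide (IsVerticalR π r'))
  termination_by w => w.length
  decreasing_by
    · simp
    · simp only [List.length_cons]
      exact Nat.lt_succ_of_le (length_dropWhile_le' _ _)

/-- `Expand_≼(π, G)`: the correct words `α` such that `[w] ≼ α` for some
expansion `w` of `(π, G)`. -/
noncomputable def ExpandPrec {σ : Schema} (π : Program σ) (G : σ.Rel)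
    (α : List (Lett σ)) : Prop :=
  Correct π α ∧ ∃ w : List (Rule σ), IsExpSeq π G w ∧ PrecEq π (descr π w) α

/-- A language is regular iff it is accepted by a finite (deterministic)
automaton. -/
def IsRegularLang {A : Type} (L : Set (List A)) : Prop :=
  ∃ (Q : Type) (_ : Fintype Q) (M : DFA A Q), ∀ w, w ∈ M.accepts ↔ w ∈ L

/-! ### The language `accept(π, G)` on words of rule bodies -/

/-- Objects of the temporal database `𝒟_w` of a composition word `w`:
spine variables and fresh copies (position, variable). -/
def WV : Type := ℕ ⊕ (ℕ × ℕ)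

/-- The spine variable at position `i` of `w`: the number of vertical bodies
strictly before position `i`. -/
noncomputable def wSpine {σ : Schema} (π : Program σ) (w : List (Rule σ)) (i : ℕ) : ℕ :=
  Set.ncard {j : Fin w.length | (j : ℕ) < i ∧ IsVerticalR π (w.get j)}

/-- The landing time of the body at position `i` of `w`. -/
noncomputable def wTime {σ : Schema} (π : Program σ) (w : List (Rule σ)) (i : ℕ) : ℤ :=
  ∑ j ∈ Finset.range i, ((w[j]?).map (idbShift π)).getD 0

/-- Renaming of the variables of the body at position `i` of `w`: head
variable ↦ current spine variable, IDB variable ↦ next spine variable, other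
variables ↦ fresh copies. -/
noncomputable def wRen {σ : Schema} (π : Program σ) (w : List (Rule σ)) (i : ℕ)
    (r : Rule σ) (v : ℕ) : WV :=
  if ∃ ii, r.hargs ii = v then Sum.inl (wSpine π w i)
  else if ∃ a, RecDecomp π r a ∧ ∃ jj, a.args jj = v then Sum.inl (wSpine π w (i + 1))
  else Sum.inr (i, v)

/-- The slices of `𝒟_w` (IDB atoms are omitted). -/
noncomputable def wSlice {σ : Schema} (π : Program σ) (w : List (Rule σ)) (t : ℤ) :
    Set (Atom σ WV) :=
  {a | ∃ i : Fin w.length, ∃ q ∈ (w.get i).body, q.R ∉ π.IDB ∧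
        t = wTime π w i + netShift q.ops ∧
        a = ⟨q.R, fun z => wRen π w i (w.get i) (q.args z)⟩}

noncomputable def wΔ {σ : Schema} (π : Program σ) (w : List (Rule σ)) : Set WV :=
  {o | ∃ t : ℤ, ∃ a ∈ wSlice π w t, ∃ i, a.2 i = o}

/-- `w ∈ accept(π, G)` : `𝒟_w, π, 0 ⊨ G(X)` (where `X` is the answer variable,
i.e. the first spine variable). -/
noncomputable def wAccept {σ : Schema} (π : Program σ) (G : σ.Rel)
    (w : List (Rule σ)) : Prop :=
  Certain π (wΔ π w) (wSlice π w) 0 ⟨G, fun _ => Sum.inl 0⟩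

/-- Unboundedness of a (plain datalog) query `(π, G)` : for every `k` there is
an expansion of length `> k` whose prefix of length `k` is not in
`accept(π, G)`. -/
noncomputable def Unbounded {σ : Schema} (π : Program σ) (G : σ.Rel) : Prop :=
  ∀ k : ℕ, ∃ w : List (Rule σ), IsExpSeq π G w ∧ w.length > k ∧ ¬ wAccept π G (w.take k)

/-- A plain (atemporal) datalog program: no temporal operators occur. -/
def Program.Plain {σ : Schema} (π : Program σ) : Prop :=
  ∀ r ∈ π.rules, ∀ p ∈ r.body, p.ops = []

/-! ### The plain datalog program `π_d` extracted from an automaton for `Accept(π, G)` -/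

/-- The schema of `π_d`: one unary relation `S_q` per automaton state `q`, the
unary goal `G`, and one binary relation per (vertical) letter of `Ω`. -/
def SchemaD (σ : Schema) (Q : Type) : Schema :=
  ⟨Q ⊕ (Unit ⊕ Lett σ), fun r => match r with
    | Sum.inl _ => 1
    | Sum.inr (Sum.inl _) => 1
    | Sum.inr (Sum.inr _) => 2⟩

/-- The plain datalog program `π_d` associated with a DFA `M` for `Accept(π,G)`:
`G(X) ← S₀(X)`;  `S_i(X) ← Λ(X,Y) ∧ S_j(Y)` for vertical transitions
`δ(s_i,Λ) = s_j`;  `S_i(X) ←` for accepting `s_i`;  and `S_i(X) ← S_j(Y)`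
whenever some word of horizontal letters drives `M` from `s_i` to `s_j`. -/
noncomputable def piD {σ : Schema} (π : Program σ) {Q : Type} [Fintype Q]
    (M : DFA (Lett σ) Q) : Program (SchemaD σ Q) :=
  ⟨ [⟨Sum.inr (Sum.inl ()), fun _ => 0, [⟨[], Sum.inl M.start, ![0]⟩]⟩] ++
    (Finset.univ.toList (α := Q)).flatMap (fun i =>
      π.rules.filterMap (fun r =>
        if IsVerticalR π r then
          some ⟨Sum.inl i, fun _ => 0,
            [⟨[], Sum.inr (Sum.inr ({Sum.inr r} : Lett σ)), ![0, 1]⟩,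
             ⟨[], Sum.inl (M.step i ({Sum.inr r} : Lett σ)), ![1]⟩]⟩
        else none)) ++
    (Finset.univ.toList (α := Q)).filterMap (fun i =>
      if i ∈ M.accept then some ⟨Sum.inl i, fun _ => 0, []⟩ else none) ++
    (Finset.univ.toList (α := Q)).flatMap (fun i =>
      (Finset.univ.toList (α := Q)).filterMap (fun j =>
        if ∃ ws : List (Lett σ), (∀ Λ ∈ ws, IsHorLett π Λ) ∧ M.evalFrom i ws = j then
          some ⟨Sum.inl i, fun _ => 0, [⟨[], Sum.inl j, ![1]⟩]⟩
        else none)) ⟩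

/-! ### Walks in a configuration graph -/

/-- There is a walk of length `n` from `x` to `y` along `E`. -/
def Reach {X : Type*} (E : X → X → Prop) (n : ℕ) (x y : X) : Prop :=
  ∃ f : ℕ → X, f 0 = x ∧ f n = y ∧ ∀ i < n, E (f i) (f (i + 1))

theorem Reach.trans {X : Type*} {E : X → X → Prop} {m n : ℕ} {x y z : X}
    (h₁ : Reach E m x y) (h₂ : Reach E n y z) : Reach E (m + n) x z := by
  obtain ⟨f, hf0, hfm, hf⟩ := h₁
  obtain ⟨g, hg0, hgn, hg⟩ := h₂
  refine ⟨fun i => if i < m then f i else g (i - m), ?_, by simpa using hgn, fun i hi => ?_⟩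
  · rcases Nat.eq_zero_or_pos m with rfl | hm
    · simpa using by rw [hg0, ← hfm, hf0]
    · simpa [hm] using hf0
  · rcases lt_trichotomy (i + 1) m with h | h | h
    · simpa [h, Nat.lt_of_succ_lt h] using hf i (Nat.lt_of_succ_lt h)
    · have hi' : i < m := by omega
      have := hf i hi'
      rw [h, hfm, ← hg0] at this
      simpa [h, hi'] using this
    · have hi' : ¬ i < m := by omega
      have hi'' : ¬ i + 1 < m := by omega
      have := hg (i - m) (by omega)
      rw [show i - m + 1 = i + 1 - m by omega] at this
      simpa [hi', hi''] using this

theorem Reach.of_segment {X : Type*} {E : X → X → Prop} {f : ℕ → X} {a b : ℕ} (hab : a ≤ b)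
    (hf : ∀ i, a ≤ i → i < b → E (f i) (f (i + 1))) : Reach E (b - a) (f a) (f b) := by
  refine ⟨fun i => f (a + i), rfl, by simp [hab], fun i hi => ?_⟩
  exact hf (a + i) (by omega) (by omega)

theorem exists_last_visit {t : ℕ → ℤ} {p : ℕ} (ht : ∀ i < p, t (i + 1) ≤ t i + 1) {h : ℤ}
    (h0 : t 0 ≤ h) (hp : h ≤ t p) :
    ∃ u ≤ p, t u = h ∧ ∀ i, u ≤ i → i ≤ p → h ≤ t i := by
  induction p with
  | zero =>
    refine ⟨0, le_rfl, le_antisymm h0 hp, fun i _ hi => ?_⟩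
    obtain rfl : i = 0 := by omega
    exact hp
  | succ p ih =>
    rcases eq_or_lt_of_le hp with heq | hlt
    · exact ⟨p + 1, le_rfl, heq.symm, fun i h₁ h₂ => by
        obtain rfl : i = p + 1 := by omega
        exact hp⟩
    · have := ht p (by omega)
      obtain ⟨u, hu, htu, hall⟩ := ih (fun i hi => ht i (by omega)) (by omega)
      refine ⟨u, by omega, htu, fun i h₁ h₂ => ?_⟩
      rcases eq_or_lt_of_le h₂ with rfl | h₃
      · exact hp
      · exact hall i h₁ (by omega)

theorem exists_first_visit {t : ℕ → ℤ} {p n : ℕ} (hpn : p ≤ n)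
    (ht : ∀ i < n, t i ≤ t (i + 1) + 1) {h : ℤ} (hp : h ≤ t p) (hn : t n ≤ h) :
    ∃ d, p ≤ d ∧ d ≤ n ∧ t d = h ∧ ∀ i, p ≤ i → i ≤ d → h ≤ t i := by
  obtain ⟨u, hu, htu, hall⟩ := exists_last_visit (t := fun j => t (n - j)) (p := n - p)
    (fun i hi => by
      have := ht (n - (i + 1)) (by omega)
      rwa [show n - (i + 1) + 1 = n - i by omega] at this)
    (h := h) (by simpa using hn) (by simpa [Nat.sub_sub_self hpn] using hp)
  refine ⟨n - u, by omega, by omega, htu, fun i h₁ h₂ => ?_⟩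
  have := hall (n - i) (by omega) (by omega)
  rwa [show n - (n - i) = i by omega] at this

theorem exists_lt_map_eq {S : Type*} {V : Set S} (hV : V.Finite) (x : ℤ) (g : ℤ → S × S)
    (hg : ∀ h, x < h → h ≤ x + V.ncard ^ 2 + 1 → g h ∈ V ×ˢ V) :
    ∃ h h', x < h ∧ h < h' ∧ h' ≤ x + V.ncard ^ 2 + 1 ∧ g h = g h' := by
  have hcard : (hV.prod hV).toFinset.card < (Finset.Icc (x + 1) (x + V.ncard ^ 2 + 1)).card := by
    rw [← Set.ncard_eq_toFinset_card _ (hV.prod hV), Set.ncard_prod, Int.card_Icc]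
    have : x + (V.ncard : ℤ) ^ 2 + 1 + 1 - (x + 1) = ((V.ncard * V.ncard + 1 : ℕ) : ℤ) := by
      push_cast; ring
    rw [this, Int.toNat_natCast]
    omega
  obtain ⟨h, hh, h', hh', hne, heq⟩ := Finset.exists_ne_map_eq_of_card_lt_of_maps_to hcard
    (f := g) (fun h hh => by
      simp only [Finset.coe_Icc, Set.mem_Icc] at hh
      simpa using hg h (by omega) hh.2)
  simp only [Finset.mem_Icc] at hh hh'
  rcases lt_or_gt_of_ne hne with hlt | hlt
  · exact ⟨h, h', by omega, hlt, hh'.2, heq⟩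
  · exact ⟨h', h, by omega, hlt, hh.2, heq.symm⟩

/-- A shortest walk from a configuration at level at most `b` to a configuration in `I` never
climbs more than `2 * |V| ^ 2` above `b`, if the graph is invariant under translations
above level `b`. -/
theorem level_le_of_shortest {S : Type*} {E : S × ℤ → S × ℤ → Prop} {I : S × ℤ → Prop} {b : ℤ}
    (hstep : ∀ x y, E x y → y.2 ≤ x.2 + 1 ∧ x.2 ≤ y.2 + 1)
    (hE : ∀ x y δ, b < x.2 → b < x.2 + δ → E x y → E (x.1, x.2 + δ) (y.1, y.2 + δ))
    (hI : ∀ x δ, b < x.2 → b < x.2 + δ → I x → I (x.1, x.2 + δ))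
    {V : Set S} (hV : V.Finite) {n : ℕ} {f : ℕ → S × ℤ} (hfV : ∀ i ≤ n, (f i).1 ∈ V)
    (hf : ∀ i < n, E (f i) (f (i + 1))) (hfI : I (f n)) (hf0 : (f 0).2 ≤ b)
    (hmin : ∀ m < n, ∀ y, I y → ¬ Reach E m (f 0) y) :
    ∀ p ≤ n, (f p).2 ≤ b + 2 * V.ncard ^ 2 := by
  intro p hp
  by_contra! hlt
  have shift : ∀ u d δ, u ≤ d → d ≤ n → (∀ i, u ≤ i → i ≤ d → b < (f i).2 ∧ b < (f i).2 + δ) →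
      Reach E (d - u) ((f u).1, (f u).2 + δ) ((f d).1, (f d).2 + δ) := fun u d δ hud hdn h =>
    Reach.of_segment (f := fun i => ((f i).1, (f i).2 + δ)) hud fun i h₁ h₂ =>
      hE _ _ _ (h i h₁ h₂.le).1 (h i h₁ h₂.le).2 (hf i (by omega))
  have pre : ∀ u ≤ n, Reach E u (f 0) (f u) := fun u hu =>
    Reach.of_segment (a := 0) (Nat.zero_le u) fun i _ h => hf i (by omega)
  rcases le_or_gt (f n).2 (b + V.ncard ^ 2) with hend | hend
  · have hU : ∀ h, b + V.ncard ^ 2 < h → h ≤ b + V.ncard ^ 2 + V.ncard ^ 2 + 1 →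
        ∃ u d, u ≤ p ∧ (f u).2 = h ∧ (∀ i, u ≤ i → i ≤ p → h ≤ (f i).2) ∧
          p ≤ d ∧ d ≤ n ∧ (f d).2 = h ∧ ∀ i, p ≤ i → i ≤ d → h ≤ (f i).2 := by
      intro h h₁ h₂
      obtain ⟨u, hu⟩ := exists_last_visit (t := fun i => (f i).2) (p := p)
        (fun i hi => (hstep _ _ (hf i (by omega))).1) (h := h)
        (hf0.trans (by nlinarith)) (by linarith)
      obtain ⟨d, hd⟩ := exists_first_visit (t := fun i => (f i).2) hp
        (fun i hi => (hstep _ _ (hf i hi)).2) (h := h) (by linarith) (by linarith)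
      exact ⟨u, d, hu.1, hu.2.1, hu.2.2, hd⟩
    choose! u d hu using hU
    obtain ⟨h, h', h₁, h₂, h₃, heq⟩ := exists_lt_map_eq hV (b + V.ncard ^ 2)
      (fun h => ((f (u h)).1, (f (d h)).1)) (fun h h₁ h₂ => by
        obtain ⟨a₁, -, -, -, a₂, -⟩ := hu h h₁ h₂
        exact ⟨hfV _ (a₁.trans hp), hfV _ a₂⟩)
    obtain ⟨heu, hed⟩ := Prod.mk.inj heq
    obtain ⟨a₁, a₂, a₃, a₄, a₅, a₆, a₇⟩ := hu h h₁ (by linarith)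
    obtain ⟨b₁, b₂, b₃, b₄, b₅, b₆, b₇⟩ := hu h' (by linarith) h₃
    have huu : u h < u h' := by
      by_contra! hle
      have := b₃ _ hle a₁
      omega
    have hdd : d h' < d h := by
      by_contra! hle
      have := b₇ _ a₄ hle
      omega
    have hN : (0 : ℤ) ≤ V.ncard ^ 2 := by positivity
    have mid := shift (u h') (d h') (h - h') (by omega) b₅ (fun i i₁ i₂ => by
      have : h' ≤ (f i).2 := by
        rcases le_total i p with hip | hip
        · exact b₃ i i₁ hip
        · exact b₇ i hip i₂
      constructor <;> linarith)
    rw [b₂, b₆, ← heu, ← hed, show h' + (h - h') = h by ring] at mid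
    have e₁ : ((f (u h)).1, h) = f (u h) := Prod.ext rfl a₂.symm
    have e₂ : ((f (d h)).1, h) = f (d h) := Prod.ext rfl a₆.symm
    rw [e₁, e₂] at mid
    have post : Reach E (n - d h) (f (d h)) (f n) := Reach.of_segment a₅ fun i _ hi => hf i hi
    exact hmin _ (by omega) _ hfI (((pre _ (by omega)).trans mid).trans post)
  · have hU : ∀ h, b < h → h ≤ b + V.ncard ^ 2 + 1 →
        ∃ u ≤ n, (f u).2 = h ∧ ∀ i, u ≤ i → i ≤ n → h ≤ (f i).2 := fun h h₁ h₂ =>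
      exists_last_visit (t := fun i => (f i).2) (p := n)
        (fun i hi => (hstep _ _ (hf i (by omega))).1) (by linarith) (by linarith)
    choose! u hu using hU
    obtain ⟨h, h', h₁, h₂, h₃, heq⟩ := exists_lt_map_eq hV b
      (fun h => ((f (u h)).1, (f (u h)).1)) (fun h h₁ h₂ =>
        ⟨hfV _ (hu h h₁ h₂).1, hfV _ (hu h h₁ h₂).1⟩)
    obtain ⟨heu, -⟩ := Prod.mk.inj heq
    obtain ⟨a₁, a₂, a₃⟩ := hu h h₁ (by linarith)
    obtain ⟨b₁, b₂, b₃⟩ := hu h' (by linarith) h₃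
    have huu : u h < u h' := by
      by_contra! hle
      have := b₃ _ hle a₁
      omega
    have post := shift (u h') n (h - h') b₁ le_rfl (fun i i₁ i₂ => by
      have := b₃ i i₁ i₂
      constructor <;> linarith)
    rw [b₂, ← heu, show h' + (h - h') = h by ring] at post
    have e₁ : ((f (u h)).1, h) = f (u h) := Prod.ext rfl a₂.symm
    rw [e₁] at post
    have hn := b₃ n b₁ le_rfl
    exact hmin _ (by omega) _ (hI (f n) (h - h') (by linarith) (by linarith) hfI)
      ((pre _ a₁).trans post)

/-! ### Translation invariance outside the temporal domain -/

theorem satOps_translate_above {σ : Schema} {Obj : Type} (D : TemporalDB σ Obj)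
    (a : Atom σ Obj) (ops : List TOp) {ℓ ℓ' : ℤ} (h : D.r + ops.length < ℓ)
    (h' : D.r + ops.length < ℓ') (hs : satOps D.slice a ops ℓ) : satOps D.slice a ops ℓ' := by
  induction ops generalizing ℓ ℓ' with
  | nil =>
    have : D.slice ℓ = ∅ := D.support ℓ (Or.inr (by simpa using h))
    simp [satOps, this] at hs
  | cons o ops ih =>
    simp only [List.length_cons, Nat.cast_add, Nat.cast_one] at h h'
    cases o with
    | onext => exact ih (by linarith) (by linarith) hs
    | oprev => exact ih (by linarith) (by linarith) hs
    | diaF =>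
      obtain ⟨m, hm, hs⟩ := hs
      exact ⟨ℓ' + 1, by linarith, ih (by linarith) (by linarith) hs⟩
    | diaP =>
      obtain ⟨m, hm, hs⟩ := hs
      rcases lt_or_ge m ℓ' with hlt | hge
      · exact ⟨m, hlt, hs⟩
      · exact ⟨D.r + ops.length + 1, by linarith, ih (by linarith) (by linarith) hs⟩

theorem satOps_translate_below {σ : Schema} {Obj : Type} (D : TemporalDB σ Obj)
    (a : Atom σ Obj) (ops : List TOp) {ℓ ℓ' : ℤ} (h : ℓ < D.l - ops.length)
    (h' : ℓ' < D.l - ops.length) (hs : satOps D.slice a ops ℓ) : satOps D.slice a ops ℓ' := by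
  induction ops generalizing ℓ ℓ' with
  | nil =>
    have : D.slice ℓ = ∅ := D.support ℓ (Or.inl (by simpa using h))
    simp [satOps, this] at hs
  | cons o ops ih =>
    simp only [List.length_cons, Nat.cast_add, Nat.cast_one] at h h'
    cases o with
    | onext => exact ih (by linarith) (by linarith) hs
    | oprev => exact ih (by linarith) (by linarith) hs
    | diaF =>
      obtain ⟨m, hm, hs⟩ := hs
      rcases lt_or_ge ℓ' m with hlt | hge
      · exact ⟨m, hlt, hs⟩
      · exact ⟨D.l - ops.length - 1, by linarith, ih (by linarith) (by linarith) hs⟩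
    | diaP =>
      obtain ⟨m, hm, hs⟩ := hs
      exact ⟨ℓ' - 1, by linarith, ih (by linarith) (by linarith) hs⟩

theorem le_foldr_max_of_mem {L : List ℕ} {x : ℕ} (h : x ∈ L) : x ≤ L.foldr max 0 := by
  induction L with
  | nil => simp at h
  | cons y L ih =>
    rcases List.mem_cons.mp h with rfl | h
    · simp
    · exact (ih h).trans (by simp)

theorem Program.length_ops_le_depth {σ : Schema} {π : Program σ} {r : Rule σ} (hr : r ∈ π.rules)
    {p : PAtom σ ℕ} (hp : p ∈ r.body) : p.ops.length ≤ π.depth :=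
  (le_foldr_max_of_mem (List.mem_map_of_mem (f := fun p => p.ops.length) hp)).trans
    (le_foldr_max_of_mem (List.mem_map_of_mem
      (f := fun r : Rule σ => (r.body.map fun p => p.ops.length).foldr max 0) hr))

/-- Two time points lie on the same side of the temporal domain of `D`, at distance
more than `K`. -/
def SameSide {σ : Schema} {Obj : Type} (D : TemporalDB σ Obj) (K : ℕ) (ℓ ℓ' : ℤ) : Prop :=
  (D.r + K < ℓ ∧ D.r + K < ℓ') ∨ (ℓ < D.l - K ∧ ℓ' < D.l - K)

theorem PAtom.sat_of_sameSide {σ : Schema} {Obj V : Type} {D : TemporalDB σ Obj} {K : ℕ}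
    {ℓ ℓ' : ℤ} (h : SameSide D K ℓ ℓ') {ν : V → Obj} {p : PAtom σ V} (hp : p.ops.length ≤ K)
    (hs : PAtom.sat D.slice ν ℓ p) : PAtom.sat D.slice ν ℓ' p := by
  rcases h with h | h
  · exact satOps_translate_above D _ _ (by omega) (by omega) hs
  · exact satOps_translate_below D _ _ (by omega) (by omega) hs

theorem StepRel.of_sameSide {σ : Schema} {Obj : Type} {π : Program σ} {D : TemporalDB σ Obj}
    {ℓ ℓ' k : ℤ} (h : SameSide D π.depth ℓ ℓ') {x y : Atom σ Obj} (hs : StepRel π D ℓ k x y) :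
    StepRel π D ℓ' k x y := by
  obtain ⟨r, hr, L₁, a, L₂, hb, ha, hL, hk, ν, hν, hx, hy, hsat⟩ := hs
  refine ⟨r, hr, L₁, a, L₂, hb, ha, hL, hk, ν, hν, hx, hy, fun p hp => ?_⟩
  refine PAtom.sat_of_sameSide h (Program.length_ops_le_depth hr ?_) (hsat p hp)
  rw [hb]
  simp only [List.mem_append, List.mem_cons] at hp ⊢
  tauto

theorem InitRel.of_sameSide {σ : Schema} {Obj : Type} {π : Program σ} {D : TemporalDB σ Obj}
    {ℓ ℓ' : ℤ} (h : SameSide D π.depth ℓ ℓ') {x : Atom σ Obj} (hs : InitRel π D ℓ x) :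
    InitRel π D ℓ' x := by
  obtain ⟨r, hr, hb, ν, hν, hx, hsat⟩ := hs
  exact ⟨r, hr, hb, ν, hν, hx, fun p hp =>
    PAtom.sat_of_sameSide h (Program.length_ops_le_depth hr hp) (hsat p hp)⟩

/-! ### Finiteness of the set of ground IDB atoms -/

theorem Program.finite_IDB {σ : Schema} (π : Program σ) : π.IDB.Finite :=
  (π.rules.map Rule.head).finite_toSet.subset fun R ⟨r, hr, h⟩ => by
    simpa using ⟨r, hr, h⟩

theorem TemporalDB.finite_Δ {σ : Schema} {Obj : Type} (D : TemporalDB σ Obj) : D.Δ.Finite := by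
  refine ((Set.finite_Icc D.l D.r).biUnion fun t _ => (D.finite t).biUnion fun a _ =>
    Set.finite_range a.2).subset ?_
  rintro d ⟨t, a, ha, i, rfl⟩
  have ht : t ∈ Set.Icc D.l D.r := by
    by_contra hn
    have : D.slice t = ∅ := D.support t (by simp only [Set.mem_Icc] at hn; omega)
    simp [this] at ha
  simp only [Set.mem_iUnion]
  exact ⟨t, ht, a, ha, i, rfl⟩

/-- The ground IDB atoms over the objects of `D`. -/
def groundIDB {σ : Schema} {Obj : Type} (π : Program σ) (D : TemporalDB σ Obj) :
    Set (Atom σ Obj) := {a | a.1 ∈ π.IDB ∧ ∀ i, a.2 i ∈ D.Δ}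

theorem groundIDB_subset {σ : Schema} {Obj : Type} {π : Program σ} (hmon : π.Monadic)
    (D : TemporalDB σ Obj) :
    groundIDB π D ⊆
      (fun p : σ.Rel × Obj => (⟨p.1, fun _ => p.2⟩ : Atom σ Obj)) '' (π.IDB ×ˢ D.Δ) := by
  rintro ⟨R, c⟩ ⟨hR, hc⟩
  have h1 : σ.arity R = 1 := hmon R hR
  have h0 : 0 < σ.arity R := by omega
  refine ⟨(R, c ⟨0, h0⟩), ⟨hR, hc _⟩, ?_⟩
  have : (fun _ => c ⟨0, h0⟩) = c := by
    funext i
    congr 1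
    ext
    simp only
    omega
  simp only [this]
  rfl

theorem groundIDB_finite {σ : Schema} {Obj : Type} {π : Program σ} (hmon : π.Monadic)
    (D : TemporalDB σ Obj) : (groundIDB π D).Finite :=
  ((π.finite_IDB.prod D.finite_Δ).image _).subset (groundIDB_subset hmon D)

theorem groundIDB_ncard_le {σ : Schema} {Obj : Type} {π : Program σ} (hmon : π.Monadic)
    (D : TemporalDB σ Obj) : (groundIDB π D).ncard ≤ Set.ncard π.IDB * Set.ncard D.Δ := by
  have hfin := π.finite_IDB.prod D.finite_Δ
  rw [← Set.ncard_prod]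
  exact (Set.ncard_le_ncard (groundIDB_subset hmon D) (hfin.image _)).trans
    (Set.ncard_image_le hfin)

theorem StepRel.mem_groundIDB {σ : Schema} {Obj : Type} {π : Program σ} {D : TemporalDB σ Obj}
    {ℓ k : ℤ} {x y : Atom σ Obj} (hs : StepRel π D ℓ k x y) : x ∈ groundIDB π D := by
  obtain ⟨r, hr, L₁, a, L₂, hb, ha, hL, hk, ν, hν, rfl, hy, hsat⟩ := hs
  exact ⟨⟨r, hr, rfl⟩, fun i => hν _⟩

theorem InitRel.mem_groundIDB {σ : Schema} {Obj : Type} {π : Program σ} {D : TemporalDB σ Obj}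
    {ℓ : ℤ} {x : Atom σ Obj} (hs : InitRel π D ℓ x) : x ∈ groundIDB π D := by
  obtain ⟨r, hr, hb, ν, hν, rfl, hsat⟩ := hs
  exact ⟨⟨r, hr, rfl⟩, fun i => hν _⟩

/-! ### Entailment sequences as walks -/

/-- The graph on timestamped ground atoms whose walks are the entailment sequences. -/
def EntEdge {σ : Schema} {Obj : Type} (π : Program σ) (D : TemporalDB σ Obj)
    (x y : Atom σ Obj × ℤ) : Prop :=
  y.2 - x.2 ∈ ({-1, 0, 1} : Set ℤ) ∧ StepRel π D x.2 (y.2 - x.2) x.1 y.1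

theorem EntEdge.level {σ : Schema} {Obj : Type} {π : Program σ} {D : TemporalDB σ Obj}
    {x y : Atom σ Obj × ℤ} (h : EntEdge π D x y) : y.2 ≤ x.2 + 1 ∧ x.2 ≤ y.2 + 1 := by
  have := h.1
  simp only [Set.mem_insert_iff, Set.mem_singleton_iff] at this
  omega

theorem EntEdge.translate {σ : Schema} {Obj : Type} {π : Program σ} {D : TemporalDB σ Obj}
    {x y : Atom σ Obj × ℤ} {δ : ℤ} (hδ : SameSide D π.depth x.2 (x.2 + δ))
    (h : EntEdge π D x y) : EntEdge π D (x.1, x.2 + δ) (y.1, y.2 + δ) := by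
  obtain ⟨h₁, h₂⟩ := h
  unfold EntEdge
  simp only [add_sub_add_right_eq_sub]
  exact ⟨h₁, h₂.of_sameSide hδ⟩

theorem Reach.of_isInitEntSeq {σ : Schema} {Obj : Type} {π : Program σ} {D : TemporalDB σ Obj}
    {n : ℕ} {A : Fin (n + 1) → Atom σ Obj} {ℓs : Fin (n + 1) → ℤ} {ks : Fin n → ℤ}
    (h : IsInitEntSeq π D n A ℓs ks) :
    Reach (EntEdge π D) n (A 0, ℓs 0) (A (Fin.last n), ℓs (Fin.last n)) := by
  have hlast : Fin.ofNat (n + 1) n = Fin.last n := by ext; simp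
  refine ⟨fun i => (A (Fin.ofNat (n + 1) i), ℓs (Fin.ofNat (n + 1) i)), rfl,
    by simp only [hlast], fun i hi => ?_⟩
  obtain ⟨h₁, h₂, h₃⟩ := h.1 ⟨i, hi⟩
  have e₁ : Fin.ofNat (n + 1) i = Fin.castSucc ⟨i, hi⟩ :=
    Fin.ext (Nat.mod_eq_of_lt (by omega))
  have e₂ : Fin.ofNat (n + 1) (i + 1) = Fin.succ ⟨i, hi⟩ :=
    Fin.ext (Nat.mod_eq_of_lt (by omega))
  simp only [EntEdge, e₁, e₂, h₃, add_sub_cancel_left]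
  exact ⟨h₁, h₂⟩

/-- For a linear monadic datalogΟ program with `○^k`-prefixed
body IDB atoms (`|k| ≤ 1`): any initialized entailment sequence starting at
`ℓ₀ ∈ [l, r]` can be replaced by one whose timestamps all lie within
`[l − K_π − M, r + K_π + M]`, where `M = 2·(|IDB(π)|·|Δ_𝒟|)²`. -/
theorem statement6 {σ : Schema} (π : Program σ) (hsafe : π.Safe) (hlin : π.Linear)
    (hmon : π.Monadic) (hpre : SmallIDBPrefix π)
    {Obj : Type} (D : TemporalDB σ Obj) (hD : OverEDB π D)
    (C0 : σ.Rel) (hC0 : C0 ∈ π.IDB) (c0 : Obj) (hc0 : c0 ∈ D.Δ)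
    (ℓ0 : ℤ) (hl : D.l ≤ ℓ0) (hr : ℓ0 ≤ D.r)
    (hex : ∃ (n : ℕ) (A : Fin (n+1) → Atom σ Obj) (ℓs : Fin (n+1) → ℤ) (ks : Fin n → ℤ),
      IsInitEntSeq π D n A ℓs ks ∧ A 0 = ⟨C0, fun _ => c0⟩ ∧ ℓs 0 = ℓ0) :
    ∃ (n : ℕ) (A : Fin (n+1) → Atom σ Obj) (ℓs : Fin (n+1) → ℤ) (ks : Fin n → ℤ),
      IsInitEntSeq π D n A ℓs ks ∧ A 0 = ⟨C0, fun _ => c0⟩ ∧ ℓs 0 = ℓ0 ∧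
      ∀ i, D.l - (π.depth : ℤ) - ((2 * (Set.ncard π.IDB * Set.ncard D.Δ)^2 : ℕ) : ℤ) ≤ ℓs i ∧
        ℓs i ≤ D.r + (π.depth : ℤ) + ((2 * (Set.ncard π.IDB * Set.ncard D.Δ)^2 : ℕ) : ℤ) := by
  obtain ⟨n₁, A₁, ℓs₁, ks₁, hseq, hA, hℓ⟩ := hex
  have hP : ∃ n, ∃ y : Atom σ Obj × ℤ,
      InitRel π D y.2 y.1 ∧ Reach (EntEdge π D) n (⟨C0, fun _ => c0⟩, ℓ0) y :=
    ⟨n₁, _, hseq.2, hA ▸ hℓ ▸ Reach.of_isInitEntSeq hseq⟩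
  obtain ⟨y, hy, f, hf0, rfl, hf⟩ := Nat.find_spec hP
  have hmin : ∀ m < Nat.find hP, ∀ z : Atom σ Obj × ℤ, InitRel π D z.2 z.1 →
      ¬ Reach (EntEdge π D) m (f 0) z := fun m hm z hz hR =>
    Nat.find_min hP hm ⟨z, hz, hf0 ▸ hR⟩
  generalize Nat.find hP = n at *
  have hfV : ∀ i ≤ n, (f i).1 ∈ groundIDB π D := fun i hi => by
    rcases eq_or_lt_of_le hi with rfl | hi
    · exact hy.mem_groundIDB
    · exact (hf i hi).2.mem_groundIDB
  have hN : 2 * ((groundIDB π D).ncard : ℤ) ^ 2 ≤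
      ((2 * (Set.ncard π.IDB * Set.ncard D.Δ) ^ 2 : ℕ) : ℤ) := by
    have := groundIDB_ncard_le hmon D
    exact_mod_cast Nat.mul_le_mul_left 2 (Nat.pow_le_pow_left this 2)
  have upper := level_le_of_shortest (E := EntEdge π D) (I := fun x => InitRel π D x.2 x.1)
    (b := D.r + π.depth) (fun _ _ h => h.level)
    (fun x y δ h₁ h₂ h => h.translate (Or.inl ⟨h₁, h₂⟩))
    (fun x δ h₁ h₂ h => h.of_sameSide (Or.inl ⟨h₁, h₂⟩))
    (groundIDB_finite hmon D) hfV hf hy (by rw [hf0]; simp only; omega) hmin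
  let neg : Atom σ Obj × ℤ → Atom σ Obj × ℤ := fun x => (x.1, -x.2)
  have hnn : ∀ x, neg (neg x) = x := fun x => by simp [neg]
  have lower := level_le_of_shortest (E := fun x y => EntEdge π D (neg x) (neg y))
    (I := fun x => InitRel π D (neg x).2 (neg x).1)
    (b := -D.l + π.depth) (fun x y h => by
      have := h.level
      simp only [neg] at this
      omega)
    (fun x y δ h₁ h₂ h => by
      have := h.translate (δ := -δ) (Or.inr (by simp only [neg]; omega))
      simpa only [neg, neg_add] using this)
    (fun x δ h₁ h₂ h => h.of_sameSide (Or.inr (by simp only [neg]; omega)))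
    (groundIDB_finite hmon D) (f := fun i => neg (f i)) (n := n) hfV
    (fun i hi => by simpa only [hnn] using hf i hi) (by simpa only [hnn] using hy)
    (by rw [hf0]; simp only [neg]; omega)
    (fun m hm z hz ⟨g, hg0, hgm, hg⟩ => hmin m hm (neg z) hz
      ⟨fun i => neg (g i), by simp only [hg0, hnn], by simp only [hgm], hg⟩)
  refine ⟨n, fun i => (f i).1, fun i => (f i).2, fun i => (f (i + 1)).2 - (f i).2,
    ⟨fun i => ?_, hy⟩, congrArg Prod.fst hf0, congrArg Prod.snd hf0, fun i => ?_⟩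
  · obtain ⟨h₁, h₂⟩ := hf i i.2
    exact ⟨h₁, h₂, by simp⟩
  · have h₁ := upper i (Nat.lt_succ_iff.mp i.2)
    have h₂ := lower i (Nat.lt_succ_iff.mp i.2)
    simp only [neg] at h₂
    constructor <;> linarith
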